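/- Let a ∈ ℝ^{n₁}, b ∈ ℝ^{n₂}, c ∈ ℝ^{n₃} be probability weight vectors with cumulative sums A_i = Σ_{l ≤ i} a_l, B_j = Σ_{l ≤ j} b_l, C_k = Σ_{l ≤ k} c_l (and A_0 = B_0 = C_0 = 0). Define the tensor Π_{ijk} = max(0, min(A_i, B_j, C_k) − max(A_{i−1}, B_{j−1}, C_{k−1})), the length of the intersection of the three intervals (A_{i−1}, A_i], (B_{j−1}, B_j], (C_{k−1}, C_k]. Then Π has nonnegative entries and its three pairwise marginals are exactly the monotone couplings: Σ_k Π_{ijk} = max(0, min(A_i, B_j) − max(A_{i−1}, B_{j−1})) for all i,j; Σ_j Π_{ijk} = max(0, min(A_i, C_k) − max(A_{i−1}, C_{k−1})) for all i,k; and Σ_i Π_{ijk} = max(0, min(B_j, C_k) − max(B_{j−1}, C_{k−1})) for all j,k. -/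

import Mathlib

open Finset

/-- The cumulative sum of a weight vector: `cumsum a i = Σ_{l < i} a_l`
(so `cumsum a 0 = 0`). -/
def cumsum {n : ℕ} (a : Fin n → ℝ) (i : ℕ) : ℝ :=
  ∑ l ∈ Finset.univ.filter (fun l : Fin n => (l : ℕ) < i), a l

/-- The length of `(s, t] ∩ (L, U]` is an increment of the length of `(L, min U x]` in `x`. -/
lemma max_zero_min_sub_max_eq_sub {L U s t : ℝ} (h : s ≤ t) :
    max 0 (min U t - max L s) = max 0 (min U t - L) - max 0 (min U s - L) := by
  grind

lemma cumsum_zero {n : ℕ} (a : Fin n → ℝ) : cumsum a 0 = 0 := by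
  simp [cumsum]

lemma cumsum_self {n : ℕ} (a : Fin n → ℝ) : cumsum a n = ∑ i, a i := by
  simp [cumsum]

lemma cumsum_mono {n : ℕ} {a : Fin n → ℝ} (ha : ∀ i, 0 ≤ a i) : Monotone (cumsum a) :=
  fun _ _ hij => Finset.sum_le_sum_of_subset_of_nonneg
    (Finset.monotone_filter_right _ fun _ _ hl => lt_of_lt_of_le hl hij) fun l _ _ => ha l

lemma cumsum_nonneg {n : ℕ} {a : Fin n → ℝ} (ha : ∀ i, 0 ≤ a i) (i : ℕ) : 0 ≤ cumsum a i :=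
  Finset.sum_nonneg fun l _ => ha l

lemma cumsum_le_sum {n : ℕ} {a : Fin n → ℝ} (ha : ∀ i, 0 ≤ a i) (i : ℕ) :
    cumsum a i ≤ ∑ l, a l :=
  Finset.sum_le_sum_of_subset_of_nonneg (Finset.filter_subset _ _) fun l _ _ => ha l

/-- The intervals `(C_{k-1}, C_k]` cut out by the cumulative sums of `c` partition any interval
`(L, U]` contained in `(0, ∑ k, c k]`. -/
lemma sum_max_zero_min_cumsum_sub_max_cumsum {n : ℕ} {c : Fin n → ℝ} (hc : ∀ k, 0 ≤ c k)
    {L U : ℝ} (hL : 0 ≤ L) (hU : U ≤ ∑ k, c k) :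
    ∑ k : Fin n, max 0 (min U (cumsum c ((k : ℕ) + 1)) - max L (cumsum c (k : ℕ))) =
      max 0 (U - L) := by
  simp_rw [max_zero_min_sub_max_eq_sub (cumsum_mono hc (Nat.le_succ _))]
  rw [Fin.sum_univ_eq_sum_range (fun k => max 0 (min U (cumsum c (k + 1)) - L) -
      max 0 (min U (cumsum c k) - L)) n,
    Finset.sum_range_sub (fun k => max 0 (min U (cumsum c k) - L)), cumsum_zero, cumsum_self,
    min_eq_left hU, max_eq_left (a := 0) (b := min U 0 - L), sub_zero]
  linarith [min_le_right U 0]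

/-- Three-way gluing of monotone couplings: given probability weight vectors `a`, `b`,
`c` with cumulative sums `A`, `B`, `C`, the tensor
`Π_{ijk} = max(0, min(A_i, B_j, C_k) − max(A_{i−1}, B_{j−1}, C_{k−1}))` is nonnegative
and its three pairwise marginals are exactly the monotone couplings of the
corresponding pairs of weight vectors. -/
theorem monotone_three_way_gluing
    {n₁ n₂ n₃ : ℕ} (a : Fin n₁ → ℝ) (b : Fin n₂ → ℝ) (c : Fin n₃ → ℝ)
    (ha : (∀ i, 0 ≤ a i) ∧ ∑ i, a i = 1) (hb : (∀ j, 0 ≤ b j) ∧ ∑ j, b j = 1)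
    (hc : (∀ k, 0 ≤ c k) ∧ ∑ k, c k = 1) :
    (∀ (i : Fin n₁) (j : Fin n₂) (k : Fin n₃),
      0 ≤ max 0 (min (min (cumsum a ((i : ℕ) + 1)) (cumsum b ((j : ℕ) + 1)))
            (cumsum c ((k : ℕ) + 1)) -
          max (max (cumsum a (i : ℕ)) (cumsum b (j : ℕ))) (cumsum c (k : ℕ)))) ∧
    (∀ (i : Fin n₁) (j : Fin n₂),
      ∑ k : Fin n₃,
        max 0 (min (min (cumsum a ((i : ℕ) + 1)) (cumsum b ((j : ℕ) + 1)))
            (cumsum c ((k : ℕ) + 1)) -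
          max (max (cumsum a (i : ℕ)) (cumsum b (j : ℕ))) (cumsum c (k : ℕ))) =
        max 0 (min (cumsum a ((i : ℕ) + 1)) (cumsum b ((j : ℕ) + 1)) -
          max (cumsum a (i : ℕ)) (cumsum b (j : ℕ)))) ∧
    (∀ (i : Fin n₁) (k : Fin n₃),
      ∑ j : Fin n₂,
        max 0 (min (min (cumsum a ((i : ℕ) + 1)) (cumsum b ((j : ℕ) + 1)))
            (cumsum c ((k : ℕ) + 1)) -
          max (max (cumsum a (i : ℕ)) (cumsum b (j : ℕ))) (cumsum c (k : ℕ))) =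
        max 0 (min (cumsum a ((i : ℕ) + 1)) (cumsum c ((k : ℕ) + 1)) -
          max (cumsum a (i : ℕ)) (cumsum c (k : ℕ)))) ∧
    (∀ (j : Fin n₂) (k : Fin n₃),
      ∑ i : Fin n₁,
        max 0 (min (min (cumsum a ((i : ℕ) + 1)) (cumsum b ((j : ℕ) + 1)))
            (cumsum c ((k : ℕ) + 1)) -
          max (max (cumsum a (i : ℕ)) (cumsum b (j : ℕ))) (cumsum c (k : ℕ))) =
        max 0 (min (cumsum b ((j : ℕ) + 1)) (cumsum c ((k : ℕ) + 1)) -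
          max (cumsum b (j : ℕ)) (cumsum c (k : ℕ)))) := by
  obtain ⟨ha, ha₁⟩ := ha
  obtain ⟨hb, hb₁⟩ := hb
  obtain ⟨hc, hc₁⟩ := hc
  refine ⟨fun _ _ _ => le_max_left _ _, fun i j => ?_, fun i k => ?_, fun j k => ?_⟩
  · exact sum_max_zero_min_cumsum_sub_max_cumsum hc (le_max_of_le_left (cumsum_nonneg ha _))
      (min_le_of_left_le ((cumsum_le_sum ha _).trans_eq (ha₁.trans hc₁.symm)))
  · simp_rw [min_right_comm _ (cumsum b _), max_right_comm _ (cumsum b _)]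
    exact sum_max_zero_min_cumsum_sub_max_cumsum hb (le_max_of_le_left (cumsum_nonneg ha _))
      (min_le_of_left_le ((cumsum_le_sum ha _).trans_eq (ha₁.trans hb₁.symm)))
  · simp_rw [min_assoc, max_assoc, min_comm (cumsum a _), max_comm (cumsum a _)]
    exact sum_max_zero_min_cumsum_sub_max_cumsum ha (le_max_of_le_left (cumsum_nonneg hb _))
      (min_le_of_left_le ((cumsum_le_sum hb _).trans_eq (hb₁.trans ha₁.symm)))
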